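/- Let k, d_in be positive integers with k ≤ d_in ≤ k², and let δ > 0. Let U, V ∈ ℝ^{k × d_in} be random matrices whose entries are independent and identically distributed uniform random variables on the interval [−δ, δ] (i.e., the joint law of the entries of (U, V) is the product of the normalized Lebesgue measures on [−δ, δ]). Then almost surely the Khatri-Rao product U ⊙ V ∈ ℝ^{k² × d_in} has full column rank, i.e., rank(U ⊙ V) = d_in almost surely. -/

import Mathlib

open MeasureTheory ProbabilityTheory

/-- The Khatri-Rao (column-wise Kronecker) product of `U : ℝ^{a × c}` and `V : ℝ^{b × c}`:
the matrix in `ℝ^{ab × c}` whose entry in row `r = (i-1)·b + l` (0-based: `r = i·b + l` with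
`i = r / b`, `l = r % b`) and column `j` is `U i j * V l j`. -/
def khatriRao {a b c : ℕ} (U : Matrix (Fin a) (Fin c) ℝ) (V : Matrix (Fin b) (Fin c) ℝ) :
    Matrix (Fin (a * b)) (Fin c) ℝ :=
  fun r j =>
    U ⟨r.1 / b, Nat.div_lt_of_lt_mul (Nat.mul_comm a b ▸ r.2)⟩ j *
    V ⟨r.1 % b, Nat.mod_lt _ (by
      rcases Nat.eq_zero_or_pos b with hb | hb
      · exact absurd r.2 (by simp [hb])
      · exact hb)⟩ j

/-- The uniform probability distribution on `[-δ, δ]`: Lebesgue measure restricted to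
`[-δ, δ]` and normalized to a probability measure. -/
noncomputable def uniformIcc (δ : ℝ) : Measure ℝ :=
  (volume (Set.Icc (-δ) δ))⁻¹ • volume.restrict (Set.Icc (-δ) δ)

/-- A nonzero real polynomial is almost everywhere nonzero for a product of atomless measures
indexed by `Fin n`. -/
lemma MvPolynomial.ae_eval_ne_zero_fin {n : ℕ} (μ : Fin n → Measure ℝ) [∀ i, SigmaFinite (μ i)]
    [∀ i, NullSingletonClass (μ i)] (p : MvPolynomial (Fin n) ℝ) (hp : p ≠ 0) :
    ∀ᵐ x ∂Measure.pi μ, MvPolynomial.eval x p ≠ 0 := by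
  induction n with
  | zero =>
    refine Filter.Eventually.of_forall fun x hx => hp ?_
    obtain ⟨a, rfl⟩ := MvPolynomial.C_surjective (Fin 0) p
    simpa using hx
  | succ n ih =>
    set q := MvPolynomial.finSuccEquiv ℝ n p with hq
    have hq0 : q ≠ 0 := by simpa [hq] using hp
    have key : ∀ᵐ z ∂(μ 0).prod (Measure.pi fun j => μ ((0 : Fin (n + 1)).succAbove j)),
        MvPolynomial.eval (Fin.cons z.1 z.2) p ≠ 0 := by
      have hmeas : MeasurableSet {z : ℝ × (Fin n → ℝ) |
          MvPolynomial.eval (Fin.cons z.1 z.2 : Fin (n + 1) → ℝ) p ≠ 0} := by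
        refine (isOpen_ne_fun ((MvPolynomial.continuous_eval p).comp ?_)
          continuous_const).measurableSet
        refine continuous_pi fun i => ?_
        refine Fin.cases ?_ (fun j => ?_) i
        · simpa using continuous_fst
        · simpa [Function.comp_def] using (continuous_apply j).comp continuous_snd
      rw [Measure.ae_prod_iff_ae_ae hmeas,
        Measure.ae_ae_comm (p := fun a s => MvPolynomial.eval (Fin.cons a s) p ≠ 0) hmeas]
      filter_upwards [ih (fun j => μ ((0 : Fin (n + 1)).succAbove j)) q.leadingCoeff
        (by simpa using hq0)] with s hs
      have hmap : q.map (MvPolynomial.eval s) ≠ 0 := fun h => hs <| by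
        simpa using congrArg (fun r => r.coeff q.natDegree) h
      refine measure_mono_null (fun a ha => ?_)
        ((Polynomial.finite_setOfPred_isRoot hmap).measure_zero (μ 0))
      simpa [MvPolynomial.eval_eq_eval_mv_eval', hq] using ha
    filter_upwards [(measurePreserving_piFinSuccAbove μ 0).quasiMeasurePreserving.ae key] with x hx
    convert hx using 3
    exact (Fin.cons_self_tail x).symm

/-- A nonzero real polynomial in finitely many variables is almost everywhere nonzero for a
product of atomless measures. -/
lemma MvPolynomial.ae_eval_ne_zero {ι : Type*} [Fintype ι] (μ : ι → Measure ℝ)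
    [∀ i, SigmaFinite (μ i)] [∀ i, NullSingletonClass (μ i)] (p : MvPolynomial ι ℝ) (hp : p ≠ 0) :
    ∀ᵐ x ∂Measure.pi μ, MvPolynomial.eval x p ≠ 0 := by
  let e := (Fintype.equivFin ι).symm
  have hmp := measurePreserving_piCongrLeft μ e
  rw [← hmp.map_eq, ae_map_iff hmp.measurable.aemeasurable
    (isOpen_ne_fun (MvPolynomial.continuous_eval p) continuous_const).measurableSet]
  have hp' : MvPolynomial.rename e.symm p ≠ 0 := fun h =>
    hp (MvPolynomial.rename_injective _ e.symm.injective (by simpa using h))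
  filter_upwards [MvPolynomial.ae_eval_ne_zero_fin (fun i => μ (e i)) _ hp'] with x hx
  rw [MvPolynomial.eval_rename] at hx
  convert hx using 3
  ext i
  obtain ⟨j, rfl⟩ := e.surjective i
  simp [MeasurableEquiv.piCongrLeft, Equiv.piCongrLeft_apply_apply]

/-- The matrix formed by the first `c` rows of the Khatri-Rao product of two `k × c` matrices of
indeterminates. -/
noncomputable def khatriRaoGenericMinor {k c : ℕ} (h : c ≤ k * k) :
    Matrix (Fin c) (Fin c) (MvPolynomial (Fin 2 × Fin k × Fin c) ℝ) :=
  fun r j =>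
    MvPolynomial.X (0, ⟨r.1 / k, Nat.div_lt_of_lt_mul (r.2.trans_le h)⟩, j) *
    MvPolynomial.X (1, ⟨r.1 % k, Nat.mod_lt _ (Nat.pos_of_ne_zero fun hk => by
      subst hk; exact absurd r.2 (by lia))⟩, j)

lemma eval_khatriRaoGenericMinor {k c : ℕ} (h : c ≤ k * k) (ω : Fin 2 × Fin k × Fin c → ℝ) :
    (MvPolynomial.eval ω).mapMatrix (khatriRaoGenericMinor h) =
      (khatriRao (fun i j => ω (0, i, j)) (fun i j => ω (1, i, j))).submatrix
        (Fin.castLE h) id := by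
  ext r j
  simp [khatriRaoGenericMinor, khatriRao]

/-- The determinant does not vanish: choosing as `j`-th columns the standard basis vectors with
indices `j / k` and `j % k` evaluates the minor to the identity matrix. -/
lemma det_khatriRaoGenericMinor_ne_zero {k c : ℕ} (h : c ≤ k * k) :
    (khatriRaoGenericMinor h).det ≠ 0 := by
  intro h0
  let ω : Fin 2 × Fin k × Fin c → ℝ := fun x =>
    if x.1 = 0 then (if x.2.1.1 = x.2.2.1 / k then 1 else 0)
    else (if x.2.1.1 = x.2.2.1 % k then 1 else 0)
  have h1 : (MvPolynomial.eval ω).mapMatrix (khatriRaoGenericMinor h) = 1 := by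
    ext r j
    by_cases hrj : r = j
    · subst hrj
      simp [khatriRaoGenericMinor, ω]
    · have hne : r.1 / k = j.1 / k → r.1 % k ≠ j.1 % k := fun hd hm => hrj <| Fin.ext <| by
        rw [← Nat.div_add_mod r.1 k, ← Nat.div_add_mod j.1 k, hd, hm]
      simpa [khatriRaoGenericMinor, ω, Matrix.one_apply_ne hrj, imp_false] using
        fun hm hd => hne hd hm
  simpa [RingHom.map_det, h1] using congrArg (MvPolynomial.eval ω) h0

instance (δ : ℝ) : NullSingletonClass (uniformIcc δ) := by
  unfold uniformIcc
  exact ⟨fun x => by simp⟩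

lemma isFiniteMeasure_uniformIcc {δ : ℝ} (hδ : 0 < δ) : IsFiniteMeasure (uniformIcc δ) := by
  refine Measure.smul_finite _ (ENNReal.inv_ne_top.2 ?_)
  simp [hδ]

/-- If the entries of `U, V ∈ ℝ^{k × d_in}`, with `k ≤ d_in ≤ k²`, are i.i.d. uniform
random variables on `[-δ, δ]` with `δ > 0`, then almost surely the Khatri-Rao product
`U ⊙ V ∈ ℝ^{k² × d_in}` has full column rank `d_in`. -/
theorem khatriRao_uniform_fullRank (k dIn : ℕ) (hk : 0 < k) (hdIn : 0 < dIn)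
    (h₁ : k ≤ dIn) (h₂ : dIn ≤ k ^ 2) (δ : ℝ) (hδ : 0 < δ) :
    ∀ᵐ ω ∂(Measure.pi fun _ : Fin 2 × Fin k × Fin dIn => uniformIcc δ),
      (khatriRao (fun i j => ω (0, i, j)) (fun i j => ω (1, i, j))).rank = dIn := by
  have := isFiniteMeasure_uniformIcc hδ
  have h : dIn ≤ k * k := by rwa [← sq]
  filter_upwards [MvPolynomial.ae_eval_ne_zero (fun _ => uniformIcc δ) _
    (det_khatriRaoGenericMinor_ne_zero h)] with ω hω
  rw [RingHom.map_det, eval_khatriRaoGenericMinor] at hω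
  refine le_antisymm (Matrix.rank_le_width _) ?_
  have hrank := Matrix.rank_of_isUnit _ ((Matrix.isUnit_iff_isUnit_det _).2 hω.isUnit)
  rw [Fintype.card_fin] at hrank
  exact hrank.symm.le.trans (Matrix.rank_submatrix_le _ _ _)
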